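/- In the market M_k, let q ∈ (0,1] satisfy ⌈kq⌉ = 2 and let P1′ be the preference of doctor d1 that ranks x¹ P ∅ with all other contracts unacceptable. Then P1′ is an obvious manipulation of the q-quantile stable mechanism φ^q at the true preference P1: P1′ is a manipulation of φ^q at P1, and both W_{d1}(P1, O^{φ^q}(P1′)) P1 W_{d1}(P1, O^{φ^q}(P1)) and C_{d1}(P1, O^{φ^q}(P1′)) P1 C_{d1}(P1, O^{φ^q}(P1)) hold. -/

import Mathlib

/-- A one-to-one matching market with contracts: a finite set `X` of contracts,
finite sets `D` of doctors and `H` of hospitals, maps assigning to each contract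
its doctor and its hospital, and fixed, publicly known hospital preferences
(strict linear orders over the hospital's contracts together with `none` = ∅). -/
structure Market where
  X : Type
  D : Type
  H : Type
  [fintypeX : Fintype X]
  [fintypeD : Fintype D]
  [fintypeH : Fintype H]
  [decEqX : DecidableEq X]
  [decEqD : DecidableEq D]
  [decEqH : DecidableEq H]
  doc : X → D
  hos : X → H
  hpref : ∀ h : H, LinearOrder (Option {x : X // hos x = h})

attribute [instance] Market.fintypeX Market.fintypeD Market.fintypeH
attribute [instance] Market.decEqX Market.decEqD Market.decEqH

namespace Market

variable (M : Market)

/-- The contracts involving doctor `d`. -/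
abbrev Xd (d : M.D) : Type := {x : M.X // M.doc x = d}

/-- The contracts involving hospital `h`. -/
abbrev Xh (h : M.H) : Type := {x : M.X // M.hos x = h}

/-- A (strict) preference for doctor `d`: a linear order on `X_d ∪ {∅}`,
where `none` plays the role of ∅ and "larger" means "more preferred". -/
abbrev DocPref (d : M.D) : Type := LinearOrder (Option (M.Xd d))

/-- A profile of doctor preferences. -/
abbrev Prof : Type := ∀ d : M.D, M.DocPref d

/-- `Y` is an allocation: distinct contracts of `Y` involve distinct doctors and
distinct hospitals. -/
def IsAllocation (Y : Finset M.X) : Prop :=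
  ∀ x ∈ Y, ∀ y ∈ Y, x ≠ y → M.doc x ≠ M.doc y ∧ M.hos x ≠ M.hos y

/-- `Y_d`: the contract of `Y` involving doctor `d` (there is a unique one when `Y`
is an allocation), or `none` (= ∅) if there is none. -/
noncomputable def allocD (Y : Finset M.X) (d : M.D) : Option (M.Xd d) :=
  if h : ∃ x ∈ Y, M.doc x = d then some ⟨h.choose, h.choose_spec.2⟩ else none

/-- `Y_h`: the contract of `Y` involving hospital `h`, or `none` (= ∅) if there is none. -/
noncomputable def allocH (Y : Finset M.X) (h : M.H) : Option (M.Xh h) :=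
  if hh : ∃ x ∈ Y, M.hos x = h then some ⟨hh.choose, hh.choose_spec.2⟩ else none

/-- Individual rationality: every agent weakly prefers its assignment to ∅. -/
def IndividuallyRational (P : M.Prof) (Y : Finset M.X) : Prop :=
  (∀ d : M.D, (P d).le none (M.allocD Y d)) ∧
  (∀ h : M.H, (M.hpref h).le none (M.allocH Y h))

/-- Contract `x` blocks `Y`: `x ∉ Y` and both the doctor and the hospital of `x`
strictly prefer `x` to their assignment under `Y`. -/
def Blocks (P : M.Prof) (Y : Finset M.X) (x : M.X) : Prop :=
  x ∉ Y ∧ (P (M.doc x)).lt (M.allocD Y (M.doc x)) (some ⟨x, rfl⟩) ∧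
    (M.hpref (M.hos x)).lt (M.allocH Y (M.hos x)) (some ⟨x, rfl⟩)

/-- `Y` is stable: it is an individually rational allocation and no contract blocks it. -/
def IsStable (P : M.Prof) (Y : Finset M.X) : Prop :=
  M.IsAllocation Y ∧ M.IndividuallyRational P Y ∧ ∀ x : M.X, ¬ M.Blocks P Y x

/-- A (matching) mechanism: a map from doctor-preference profiles to sets of contracts. -/
abbrev Mech : Type := M.Prof → Finset M.X

/-- `φ_d(P)`: the contract assigned to doctor `d` by mechanism `φ` at profile `P`. -/
noncomputable def assign (φ : M.Mech) (P : M.Prof) (d : M.D) : Option (M.Xd d) :=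
  M.allocD (φ P) d

/-- `Pd'` is a manipulation of `φ` at true preference `Pd` for doctor `d`:
for some subprofile of the other doctors, reporting `Pd'` yields an outcome that
`d` strictly prefers (under the true `Pd`) to the outcome from reporting `Pd`. -/
def IsManipulation (φ : M.Mech) (d : M.D) (Pd Pd' : M.DocPref d) : Prop :=
  ∃ P : M.Prof,
    Pd.lt (M.assign φ (Function.update P d Pd) d) (M.assign φ (Function.update P d Pd') d)

/-- `φ` is non-manipulable (strategy-proof). -/
def NonManipulable (φ : M.Mech) : Prop :=
  ∀ (d : M.D) (Pd Pd' : M.DocPref d), ¬ M.IsManipulation φ d Pd Pd'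

/-- The option set `O^φ(Pd)` left open by report `Pd` of doctor `d`. -/
def optionSet (φ : M.Mech) (d : M.D) (Pd : M.DocPref d) : Set (Option (M.Xd d)) :=
  {o | ∃ P : M.Prof, o = M.assign φ (Function.update P d Pd) d}

/-- `a` is the `Pd`-worst element of `S` (i.e. `a = W_d(Pd, S)`). -/
def IsWorst (d : M.D) (Pd : M.DocPref d) (S : Set (Option (M.Xd d)))
    (a : Option (M.Xd d)) : Prop :=
  a ∈ S ∧ ∀ b ∈ S, Pd.le a b

/-- `a` is the `Pd`-best element of `S` (i.e. `a = C_d(Pd, S)`). -/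
def IsBest (d : M.D) (Pd : M.DocPref d) (S : Set (Option (M.Xd d)))
    (a : Option (M.Xd d)) : Prop :=
  a ∈ S ∧ ∀ b ∈ S, Pd.le b a

/-- `Pd'` is an obvious manipulation of `φ` at `Pd`: it is a manipulation and either
`W_d(Pd, O^φ(Pd')) P_d W_d(Pd, O^φ(Pd))` or `C_d(Pd, O^φ(Pd')) P_d C_d(Pd, O^φ(Pd))`. -/
def IsObviousManipulation (φ : M.Mech) (d : M.D) (Pd Pd' : M.DocPref d) : Prop :=
  M.IsManipulation φ d Pd Pd' ∧
    ((∃ a b, M.IsWorst d Pd (M.optionSet φ d Pd') a ∧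
        M.IsWorst d Pd (M.optionSet φ d Pd) b ∧ Pd.lt b a) ∨
     (∃ a b, M.IsBest d Pd (M.optionSet φ d Pd') a ∧
        M.IsBest d Pd (M.optionSet φ d Pd) b ∧ Pd.lt b a))

/-- `φ` is not obviously manipulable (NOM). -/
def NOM (φ : M.Mech) : Prop :=
  ∀ (d : M.D) (Pd Pd' : M.DocPref d), ¬ M.IsObviousManipulation φ d Pd Pd'

open Classical in
/-- The (finite) set of all stable allocations at profile `P`. -/
noncomputable def stableSet (P : M.Prof) : Finset (Finset M.X) :=
  @Finset.filter _ (fun Y => M.IsStable P Y) (Classical.decPred _) Finset.univ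

/-- The list of doctor `d`'s assignments across all stable allocations at `P`
(with multiplicity), ordered from best to worst according to `P d`. -/
noncomputable def sortedStable (P : M.Prof) (d : M.D) : List (Option (M.Xd d)) :=
  letI := P d
  ((M.stableSet P).val.map (fun Y => M.allocD Y d)).sort (· ≥ ·)

/-- `X^{(j)}_d`: doctor `d`'s `j`-th best stable assignment at `P` (for `1 ≤ j ≤ k`,
`k` the number of stable allocations). -/
noncomputable def nthBest (P : M.Prof) (d : M.D) (j : ℕ) : Option (M.Xd d) :=
  ((M.sortedStable P d)[j - 1]?).join

/-- The `j`-th quantile stable allocation `X^{(j)} = ⋃_{d ∈ D} X^{(j)}_d` at `P`. -/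
noncomputable def quantileAlloc (P : M.Prof) (j : ℕ) : Finset M.X :=
  Finset.univ.filter (fun x => M.nthBest P (M.doc x) j = some ⟨x, rfl⟩)

/-- The `q`-quantile stable mechanism `φ^q`: at a profile with `k` stable allocations
it selects the `⌈kq⌉`-th quantile stable allocation (with `⌈0⌉` taken to be `1`). -/
noncomputable def quantileMech (q : ℝ) : M.Mech :=
  fun P => M.quantileAlloc P (max 1 ⌈((M.stableSet P).card : ℝ) * q⌉₊)

/-- `Y` is the doctor-optimal stable allocation at `P`: it is stable and every doctor
weakly prefers it to every other stable allocation. -/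
def IsDoctorOptimal (P : M.Prof) (Y : Finset M.X) : Prop :=
  M.IsStable P Y ∧
    ∀ Z : Finset M.X, M.IsStable P Z → ∀ d : M.D, (P d).le (M.allocD Z d) (M.allocD Y d)

/-- `Y` is the hospital-optimal stable allocation at `P`. -/
def IsHospitalOptimal (P : M.Prof) (Y : Finset M.X) : Prop :=
  M.IsStable P Y ∧
    ∀ Z : Finset M.X, M.IsStable P Z → ∀ h : M.H, (M.hpref h).le (M.allocH Z h) (M.allocH Y h)

end Market

namespace MkMarket

/-- Doctor map for the market `M_k`: contracts `x^t` (encoded `Sum.inl t`) belong to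
doctor `d1 = false`; contract `w` (encoded `Sum.inr ()`) belongs to doctor `d2 = true`. -/
def mdoc (k : ℕ) : (Fin k ⊕ Unit) → Bool := Sum.elim (fun _ => false) (fun _ => true)

/-- Hospital map for the market `M_k`: each `x^t` involves hospital `h1 = false`
and `w` involves hospital `h2 = true`. -/
def mhos (k : ℕ) : (Fin k ⊕ Unit) → Bool := Sum.elim (fun _ => false) (fun _ => true)

/-- Ranking realizing the fixed hospital preferences of `M_k`:
`h1` ranks `x^k P x^{k-1} P … P x^1 P ∅`, and `h2` ranks `w P ∅`. -/
def hrank (k : ℕ) (h : Bool) : Option {x : Fin k ⊕ Unit // mhos k x = h} → ℕ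
  | none => 0
  | some ⟨Sum.inl t, _⟩ => t.val + 1
  | some ⟨Sum.inr _, _⟩ => 1

lemma hrank_injective (k : ℕ) (h : Bool) : Function.Injective (hrank k h) := by
  rintro (_ | ⟨(t | u), hx⟩) (_ | ⟨(s | v), hy⟩) hab <;>
    simp only [hrank] at hab
  · rfl
  · omega
  · exact absurd hab (by omega)
  · omega
  · have : t = s := Fin.ext (by omega)
    subst this; rfl
  · exact Bool.noConfusion (hx.trans hy.symm)
  · exact absurd hab (by omega)
  · exact Bool.noConfusion (hy.trans hx.symm)
  · rfl

/-- The market `M_k` of the proof of the Theorem: doctors `d1 = false`, `d2 = true`,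
hospitals `h1 = false`, `h2 = true`, contracts `x^1, …, x^k` (encoded as `Sum.inl 0, …,
Sum.inl (k-1)`) between `d1` and `h1`, and `w` (encoded `Sum.inr ()`) between `d2` and `h2`;
hospital preferences: `x^k P … P x^1 P ∅` for `h1` and `w P ∅` for `h2`. -/
def Mk (k : ℕ) : Market where
  X := Fin k ⊕ Unit
  D := Bool
  H := Bool
  doc := mdoc k
  hos := mhos k
  hpref h := LinearOrder.lift' (hrank k h) (hrank_injective k h)

/-- The contract `x^{t+1}` of `M_k`, viewed as a contract of doctor `d1 = false`. -/
def xC (k : ℕ) (t : Fin k) : (Mk k).Xd false := ⟨Sum.inl t, rfl⟩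

/-- The contract `w` of `M_k`, viewed as a contract of doctor `d2 = true`. -/
def wC (k : ℕ) : (Mk k).Xd true := ⟨Sum.inr (), rfl⟩

/-- Ranking realizing `d1`'s true preference `P1 = x^1, x^2, …, x^k` (then ∅). -/
def drank1 (k : ℕ) : Option ((Mk k).Xd false) → ℕ
  | none => 0
  | some ⟨Sum.inl t, _⟩ => k - t.val
  | some ⟨Sum.inr _, _⟩ => 0

lemma drank1_injective (k : ℕ) : Function.Injective (drank1 k) := by
  rintro (_ | ⟨(t | u), hx⟩) (_ | ⟨(s | v), hy⟩) hab <;>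
    simp only [drank1] at hab
  · rfl
  · have := s.isLt; omega
  · exact Bool.noConfusion hy
  · have := t.isLt; omega
  · have h1 := t.isLt; have h2 := s.isLt
    have : t = s := Fin.ext (by omega)
    subst this; rfl
  · exact Bool.noConfusion hy
  · exact Bool.noConfusion hx
  · exact Bool.noConfusion hx
  · exact Bool.noConfusion hx

/-- `d1`'s true preference `P1`: `x^1 P x^2 P … P x^k P ∅`. -/
def P1 (k : ℕ) : (Mk k).DocPref false :=
  LinearOrder.lift' (drank1 k) (drank1_injective k)

/-- `Q` is the truncated preference `P1'` of `d1`: it ranks `x^1 P ∅` and declares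
every other contract unacceptable (`∅ P x^t` for all `t ≠ 1`). -/
def IsTruncation (k : ℕ) (hk : 0 < k) (Q : (Mk k).DocPref false) : Prop :=
  Q.lt none (some (xC k ⟨0, hk⟩)) ∧
    ∀ t : Fin k, t.val ≠ 0 → Q.lt (some (xC k t)) none

/-- Ranking realizing the truncated preference `P1' = x^1` (then ∅, then the rest). -/
def drank1' (k : ℕ) : Option ((Mk k).Xd false) → ℕ
  | none => k
  | some ⟨Sum.inl t, _⟩ => if t.val = 0 then k + 1 else k - t.val
  | some ⟨Sum.inr _, _⟩ => 0

lemma drank1'_injective (k : ℕ) : Function.Injective (drank1' k) := by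
  rintro (_ | ⟨(t | u), hx⟩) (_ | ⟨(s | v), hy⟩) hab <;>
    simp only [drank1'] at hab
  · rfl
  · have := s.isLt; split_ifs at hab <;> omega
  · exact Bool.noConfusion hy
  · have := t.isLt; split_ifs at hab <;> omega
  · have h1 := t.isLt; have h2 := s.isLt
    have : t = s := Fin.ext (by split_ifs at hab <;> omega)
    subst this; rfl
  · exact Bool.noConfusion hy
  · exact Bool.noConfusion hx
  · exact Bool.noConfusion hx
  · exact Bool.noConfusion hx

/-- A concrete realization of the truncated preference `P1'`. -/
def P1' (k : ℕ) : (Mk k).DocPref false :=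
  LinearOrder.lift' (drank1' k) (drank1'_injective k)

/-- The profile `(Q1, Q2)` of doctor preferences in `M_k`. -/
def prof (k : ℕ) (Q1 : (Mk k).DocPref false) (Q2 : (Mk k).DocPref true) : (Mk k).Prof :=
  fun d => match d with
  | false => Q1
  | true => Q2

end MkMarket

namespace Market

variable {M : Market}

lemma IsAllocation.allocD_eq_some {Y : Finset M.X} (hY : M.IsAllocation Y) {d : M.D} {x : M.X}
    (hx : x ∈ Y) (hd : M.doc x = d) : M.allocD Y d = some ⟨x, hd⟩ := by
  have h : ∃ x ∈ Y, M.doc x = d := ⟨x, hx, hd⟩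
  rw [allocD, dif_pos h, Option.some_inj, Subtype.mk.injEq]
  by_contra hne
  exact (hY _ h.choose_spec.1 x hx hne).1 (h.choose_spec.2.trans hd.symm)

lemma IsAllocation.allocH_eq_some {Y : Finset M.X} (hY : M.IsAllocation Y) {h : M.H} {x : M.X}
    (hx : x ∈ Y) (hh : M.hos x = h) : M.allocH Y h = some ⟨x, hh⟩ := by
  have h' : ∃ x ∈ Y, M.hos x = h := ⟨x, hx, hh⟩
  rw [allocH, dif_pos h', Option.some_inj, Subtype.mk.injEq]
  by_contra hne
  exact (hY _ h'.choose_spec.1 x hx hne).2 (h'.choose_spec.2.trans hh.symm)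

lemma allocD_eq_none {Y : Finset M.X} {d : M.D} (h : ∀ x ∈ Y, M.doc x ≠ d) :
    M.allocD Y d = none :=
  dif_neg fun ⟨x, hx, hd⟩ => h x hx hd

lemma allocH_eq_none {Y : Finset M.X} {h : M.H} (h' : ∀ x ∈ Y, M.hos x ≠ h) :
    M.allocH Y h = none :=
  dif_neg fun ⟨x, hx, hh⟩ => h' x hx hh

lemma mem_quantileAlloc {P : M.Prof} {j : ℕ} {x : M.X} {d : M.D} (hd : M.doc x = d) :
    x ∈ M.quantileAlloc P j ↔ M.nthBest P d j = some ⟨x, hd⟩ := by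
  subst hd
  simp [quantileAlloc]

lemma allocD_quantileAlloc (P : M.Prof) (j : ℕ) (d : M.D) :
    M.allocD (M.quantileAlloc P j) d = M.nthBest P d j := by
  by_cases h : ∃ x ∈ M.quantileAlloc P j, M.doc x = d
  · rw [allocD, dif_pos h]
    exact ((mem_quantileAlloc h.choose_spec.2).1 h.choose_spec.1).symm
  · rw [allocD, dif_neg h]
    rcases hn : M.nthBest P d j with _ | ⟨x, hx⟩
    · rfl
    · exact absurd ⟨x, (mem_quantileAlloc hx).2 hn, hx⟩ h

lemma mem_stableSet {P : M.Prof} {Y : Finset M.X} : Y ∈ M.stableSet P ↔ M.IsStable P Y := by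
  simp [stableSet]

lemma assign_quantileMech (q : ℝ) (P : M.Prof) (d : M.D) {n : ℕ} (hn : (M.stableSet P).card = n) :
    M.assign (M.quantileMech q) P d = M.nthBest P d (max 1 ⌈(n : ℝ) * q⌉₊) :=
  hn ▸ allocD_quantileAlloc P _ d

lemma sortedStable_eq {P : M.Prof} {d : M.D} {l : List (Option (M.Xd d))}
    (h : (M.stableSet P).val.map (fun Y => M.allocD Y d) = l)
    (hl : l.Pairwise fun a b => (P d).le b a) : M.sortedStable P d = l := by
  let := P d
  rw [sortedStable, h, Multiset.coe_sort]
  exact List.mergeSort_of_pairwise (by simpa using hl)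

lemma nthBest_eq {P : M.Prof} {d : M.D} {l : List (Option (M.Xd d))} {j : ℕ}
    {a : Option (M.Xd d)} (hl : M.sortedStable P d = l) (h : l[j - 1]? = some a) :
    M.nthBest P d j = a := by
  rw [nthBest, hl, h, Option.join_some]

lemma nonempty_prof (M : Market) : Nonempty M.Prof := by
  classical exact ⟨fun _ => linearOrderOfSTO WellOrderingRel⟩

/-- An option set is a singleton if the report determines the assignment. -/
lemma optionSet_eq_singleton {φ : M.Mech} {d : M.D} {Q : M.DocPref d}
    {a : Option (M.Xd d)} (h : ∀ P : M.Prof, P d = Q → M.assign φ P d = a) :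
    M.optionSet φ d Q = {a} := by
  have h' (P : M.Prof) := h (Function.update P d Q) (Function.update_self ..)
  ext b
  obtain ⟨P₀⟩ := M.nonempty_prof
  exact ⟨fun ⟨P, hP⟩ => hP.trans (h' P), fun hb => ⟨P₀, hb.trans (h' P₀).symm⟩⟩

lemma isManipulation_of_lt {φ : M.Mech} {d : M.D} {Q Q' : M.DocPref d}
    {a b : Option (M.Xd d)} (ha : ∀ P : M.Prof, P d = Q' → M.assign φ P d = a)
    (hb : ∀ P : M.Prof, P d = Q → M.assign φ P d = b) (hlt : Q.lt b a) :
    M.IsManipulation φ d Q Q' := by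
  obtain ⟨P⟩ := M.nonempty_prof
  refine ⟨P, ?_⟩
  rwa [ha _ (Function.update_self ..), hb _ (Function.update_self ..)]

lemma isWorst_singleton {d : M.D} (Q : M.DocPref d) (a : Option (M.Xd d)) :
    M.IsWorst d Q {a} a :=
  ⟨rfl, fun _ hb => hb ▸ Q.le_refl a⟩

lemma isBest_singleton {d : M.D} (Q : M.DocPref d) (a : Option (M.Xd d)) :
    M.IsBest d Q {a} a :=
  ⟨rfl, fun _ hb => hb ▸ Q.le_refl a⟩

end Market

namespace MkMarket

open Market

variable {k : ℕ}

/-- Contract `x^{t+1}` is acceptable to `d1` at the profile `P`. -/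
def Acceptable (P : (Mk k).Prof) (t : Fin k) : Prop := (P false).lt none (some (xC k t))

/-- The allocation that matches `d1` through `x^{t+1}`, and `d2` through `w` exactly when
`d2` finds `w` acceptable. -/
noncomputable def allocOf (P : (Mk k).Prof) (t : Fin k) : Finset (Mk k).X :=
  (Set.toFinite {x : (Mk k).X |
    x = Sum.inl t ∨ (x = Sum.inr () ∧ (P true).lt none (some (wC k)))}).toFinset

lemma inl_mem_allocOf {P : (Mk k).Prof} {s t : Fin k} :
    (Sum.inl s : (Mk k).X) ∈ allocOf P t ↔ s = t := by
  refine (Set.Finite.mem_toFinset _).trans ⟨fun h => ?_, fun h => .inl (h ▸ rfl)⟩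
  exact Sum.inl.inj (h.resolve_right fun h' => Sum.inl_ne_inr h'.1)

lemma inr_mem_allocOf {P : (Mk k).Prof} {t : Fin k} :
    (Sum.inr () : (Mk k).X) ∈ allocOf P t ↔ (P true).lt none (some (wC k)) := by
  refine (Set.Finite.mem_toFinset _).trans ⟨fun h => ?_, fun h => .inr ⟨rfl, h⟩⟩
  exact (h.resolve_left Sum.inr_ne_inl).2

lemma isAllocation_allocOf (P : (Mk k).Prof) (t : Fin k) : (Mk k).IsAllocation (allocOf P t) := by
  rintro (s | _) hs (r | _) hr hne
  · exact absurd (by rw [inl_mem_allocOf.1 hs, inl_mem_allocOf.1 hr]) hne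
  · exact ⟨Bool.false_ne_true, Bool.false_ne_true⟩
  · exact ⟨Bool.false_ne_true.symm, Bool.false_ne_true.symm⟩
  · exact absurd rfl hne

lemma allocD_false_eq {Y : Finset (Mk k).X} (hY : (Mk k).IsAllocation Y) {t : Fin k}
    (ht : (Sum.inl t : (Mk k).X) ∈ Y) : (Mk k).allocD Y false = some (xC k t) :=
  hY.allocD_eq_some ht rfl

lemma allocD_true_eq {Y : Finset (Mk k).X} (hY : (Mk k).IsAllocation Y)
    (hw : (Sum.inr () : (Mk k).X) ∈ Y) : (Mk k).allocD Y true = some (wC k) :=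
  hY.allocD_eq_some hw rfl

lemma allocH_false_eq {Y : Finset (Mk k).X} (hY : (Mk k).IsAllocation Y) {t : Fin k}
    (ht : (Sum.inl t : (Mk k).X) ∈ Y) : (Mk k).allocH Y false = some ⟨Sum.inl t, rfl⟩ :=
  hY.allocH_eq_some ht rfl

lemma allocD_allocOf (P : (Mk k).Prof) (t : Fin k) :
    (Mk k).allocD (allocOf P t) false = some (xC k t) :=
  allocD_false_eq (isAllocation_allocOf P t) (inl_mem_allocOf.2 rfl)

lemma none_le_hpref (h : (Mk k).H) (a : Option ((Mk k).Xh h)) : ((Mk k).hpref h).le none a :=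
  Nat.zero_le (hrank k h a)

lemma allocD_true_eq_none {Y : Finset (Mk k).X} (h : (Sum.inr () : (Mk k).X) ∉ Y) :
    (Mk k).allocD Y true = none := by
  refine allocD_eq_none ?_
  rintro (s | _) hs
  · exact Bool.false_ne_true
  · exact absurd hs h

lemma allocH_true_eq_none {Y : Finset (Mk k).X} (h : (Sum.inr () : (Mk k).X) ∉ Y) :
    (Mk k).allocH Y true = none := by
  refine allocH_eq_none ?_
  rintro (s | _) hs
  · exact Bool.false_ne_true
  · exact absurd hs h

/-- If the contracts acceptable to `d1` are ranked by `d1` oppositely to `h1`, every acceptable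
contract is part of a stable allocation. -/
lemma isStable_allocOf {P : (Mk k).Prof}
    (hanti : ∀ s t, Acceptable P s → Acceptable P t → t < s →
      (P false).lt (some (xC k s)) (some (xC k t)))
    {t : Fin k} (ht : Acceptable P t) : (Mk k).IsStable P (allocOf P t) := by
  have hA := isAllocation_allocOf P t
  refine ⟨hA, ⟨?_, fun h => none_le_hpref h _⟩, ?_⟩
  · rintro (_ | _)
    · rw [allocD_allocOf]
      exact @le_of_lt _ (P false).toPreorder _ _ ht
    · by_cases hw : (P true).lt none (some (wC k))
      · rw [allocD_true_eq hA (inr_mem_allocOf.2 hw)]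
        exact @le_of_lt _ (P true).toPreorder _ _ hw
      · rw [allocD_true_eq_none (mt inr_mem_allocOf.1 hw)]
        exact @le_refl _ (P true).toPreorder _
  · rintro (s | _) ⟨hx, hd, hh⟩
    · have hd' : (P false).lt (some (xC k t)) (some (xC k s)) := by
        rw [← allocD_allocOf P t]; exact hd
      have hh' : t < s := by
        change ((Mk k).hpref false).lt ((Mk k).allocH (allocOf P t) false) _ at hh
        rw [allocH_false_eq hA (inl_mem_allocOf.2 rfl)] at hh
        exact Nat.succ_lt_succ_iff.1 hh
      have hs : Acceptable P s := @lt_trans _ (P false).toPreorder _ _ _ ht hd'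
      exact @lt_asymm _ (P false).toPreorder _ _ hd' (hanti s t hs ht hh')
    · change (P true).lt ((Mk k).allocD (allocOf P t) true) _ at hd
      rw [allocD_true_eq_none hx] at hd
      exact hx (inr_mem_allocOf.2 hd)

/-- If `d1` finds some contract acceptable, every stable allocation matches `d1` through an
acceptable contract, and `d2` through `w` exactly when `d2` finds `w` acceptable. -/
lemma eq_allocOf_of_isStable {P : (Mk k).Prof} (hne : ∃ t, Acceptable P t)
    {Y : Finset (Mk k).X} (hY : (Mk k).IsStable P Y) :
    ∃ t, Acceptable P t ∧ allocOf P t = Y := by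
  obtain ⟨hA, ⟨hIR, -⟩, hB⟩ := hY
  have hmem : ∃ t : Fin k, (Sum.inl t : (Mk k).X) ∈ Y := by
    by_contra! hno
    obtain ⟨t, ht⟩ := hne
    refine hB (Sum.inl t) ⟨hno t, ?_, ?_⟩
    · have : (Mk k).allocD Y false = none := by
        refine allocD_eq_none ?_
        rintro (s | _) hs
        · exact absurd hs (hno s)
        · exact Bool.false_ne_true.symm
      change (P false).lt ((Mk k).allocD Y false) _
      rw [this]
      exact ht
    · have : (Mk k).allocH Y false = none := by
        refine allocH_eq_none ?_
        rintro (s | _) hs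
        · exact absurd hs (hno s)
        · exact Bool.false_ne_true.symm
      change ((Mk k).hpref false).lt ((Mk k).allocH Y false) _
      rw [this]
      exact Nat.succ_pos t.val
  obtain ⟨t, ht⟩ := hmem
  refine ⟨t, ?_, ?_⟩
  · have h := hIR false
    rw [allocD_false_eq hA ht] at h
    exact @lt_of_le_of_ne _ (P false).toPartialOrder _ _ h (Option.some_ne_none _).symm
  · ext x
    rcases x with s | _
    · refine inl_mem_allocOf.trans ⟨fun h => h ▸ ht, fun hs => ?_⟩
      by_contra hst
      exact (hA _ hs _ ht fun h => hst (Sum.inl.inj h)).1 rfl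
    · refine inr_mem_allocOf.trans ⟨fun hw => ?_, fun hmem => ?_⟩
      · by_contra hno
        refine hB (Sum.inr ()) ⟨hno, ?_, ?_⟩
        · change (P true).lt ((Mk k).allocD Y true) _
          rw [allocD_true_eq_none hno]
          exact hw
        · change ((Mk k).hpref true).lt ((Mk k).allocH Y true) _
          rw [allocH_true_eq_none hno]
          exact Nat.one_pos
      · have h := hIR true
        rw [allocD_true_eq hA hmem] at h
        exact @lt_of_le_of_ne _ (P true).toPartialOrder _ _ h (Option.some_ne_none _).symm

lemma allocOf_injective (P : (Mk k).Prof) : Function.Injective (allocOf P) := fun s t h =>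
  inl_mem_allocOf.1 (h ▸ inl_mem_allocOf.2 rfl : (Sum.inl s : (Mk k).X) ∈ allocOf P t)

lemma stableSet_eq_map {P : (Mk k).Prof} {s : Finset (Fin k)} (hs : ∀ t, t ∈ s ↔ Acceptable P t)
    (hne : s.Nonempty)
    (hanti : ∀ s t, Acceptable P s → Acceptable P t → t < s →
      (P false).lt (some (xC k s)) (some (xC k t))) :
    (Mk k).stableSet P = s.map ⟨allocOf P, allocOf_injective P⟩ := by
  ext Y
  rw [mem_stableSet, Finset.mem_map]
  constructor
  · intro hY
    obtain ⟨t, ht, rfl⟩ := eq_allocOf_of_isStable (hne.imp fun t => (hs t).1) hY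
    exact ⟨t, (hs t).2 ht, rfl⟩
  · rintro ⟨t, ht, rfl⟩
    exact isStable_allocOf hanti ((hs t).1 ht)

lemma map_allocD_stableSet {P : (Mk k).Prof} {s : Finset (Fin k)}
    (h : (Mk k).stableSet P = s.map ⟨allocOf P, allocOf_injective P⟩) :
    ((Mk k).stableSet P).val.map (fun Y => (Mk k).allocD Y false) =
      s.val.map fun t => some (xC k t) := by
  rw [h, Finset.map_val, Multiset.map_map]
  exact Multiset.map_congr rfl fun t _ => allocD_allocOf P t

lemma P1_lt_iff {s t : Fin k} : (P1 k).lt (some (xC k s)) (some (xC k t)) ↔ t < s := by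
  change k - s.val < k - t.val ↔ t.val < s.val
  omega

lemma stableSet_of_P1 (hk : 0 < k) {P : (Mk k).Prof} (hP : P false = P1 k) :
    (Mk k).stableSet P = Finset.univ.map ⟨allocOf P, allocOf_injective P⟩ := by
  refine stableSet_eq_map (fun t => ⟨fun _ => ?_, fun _ => Finset.mem_univ t⟩)
    ⟨⟨0, hk⟩, Finset.mem_univ _⟩ fun s t _ _ hst => ?_
  · rw [Acceptable, hP]
    exact Nat.sub_pos_of_lt t.isLt
  · rw [hP]
    exact P1_lt_iff.2 hst

lemma sortedStable_of_P1 (hk : 0 < k) {P : (Mk k).Prof} (hP : P false = P1 k) :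
    (Mk k).sortedStable P false = (List.finRange k).map fun t => some (xC k t) := by
  refine sortedStable_eq (map_allocD_stableSet (stableSet_of_P1 hk hP)) ?_
  rw [hP, List.pairwise_map]
  exact (List.pairwise_lt_finRange k).imp fun h =>
    @le_of_lt _ (P1 k).toPreorder _ _ (P1_lt_iff.2 h)

lemma assign_of_P1 (hk : 2 ≤ k) {q : ℝ} (hceil : ⌈(k : ℝ) * q⌉ = 2)
    {P : (Mk k).Prof} (hP : P false = P1 k) :
    (Mk k).assign ((Mk k).quantileMech q) P false = some (xC k ⟨1, hk⟩) := by
  have hcard : ((Mk k).stableSet P).card = k := by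
    rw [stableSet_of_P1 (by omega) hP, Finset.card_map, Finset.card_univ, Fintype.card_fin]
  have hnat : ⌈(k : ℝ) * q⌉₊ = 2 := by rw [← Int.ceil_toNat, hceil]; rfl
  refine (assign_quantileMech q P false hcard).trans ?_
  rw [hnat]
  refine nthBest_eq (sortedStable_of_P1 (by omega) hP) ?_
  have hlen : 1 < k := hk
  simp [hlen]

lemma stableSet_of_truncation (hk : 0 < k) {Q : (Mk k).DocPref false}
    (hQ : IsTruncation k hk Q) {P : (Mk k).Prof} (hP : P false = Q) :
    (Mk k).stableSet P =
      ({⟨0, hk⟩} : Finset (Fin k)).map ⟨allocOf P, allocOf_injective P⟩ := by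
  have hacc : ∀ t, t = ⟨0, hk⟩ ↔ Acceptable P t := by
    intro t
    rw [Acceptable, hP]
    refine ⟨fun h => h ▸ hQ.1, fun h => ?_⟩
    by_contra hne
    exact @lt_asymm _ Q.toPreorder _ _ h (hQ.2 t fun h0 => hne (Fin.ext h0))
  refine stableSet_eq_map (fun t => Finset.mem_singleton.trans (hacc t))
    (Finset.singleton_nonempty _) fun s t hs ht hst => ?_
  exact absurd (((hacc t).2 ht).trans ((hacc s).2 hs).symm) hst.ne

lemma assign_of_truncation (hk : 0 < k) {q : ℝ} (hq0 : 0 < q) (hq1 : q ≤ 1)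
    {Q : (Mk k).DocPref false} (hQ : IsTruncation k hk Q) {P : (Mk k).Prof} (hP : P false = Q) :
    (Mk k).assign ((Mk k).quantileMech q) P false = some (xC k ⟨0, hk⟩) := by
  have hset := stableSet_of_truncation hk hQ hP
  have hcard : ((Mk k).stableSet P).card = 1 := by rw [hset, Finset.card_map, Finset.card_singleton]
  have hnat : ⌈((1 : ℕ) : ℝ) * q⌉₊ = 1 := by
    rw [Nat.cast_one, one_mul, Nat.ceil_eq_iff one_ne_zero]
    simpa using ⟨hq0, hq1⟩
  refine (assign_quantileMech q P false hcard).trans ?_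
  rw [hnat]
  exact nthBest_eq (sortedStable_eq (l := [some (xC k ⟨0, hk⟩)]) (map_allocD_stableSet hset)
    (List.pairwise_singleton ..)) rfl

end MkMarket

open MkMarket in
/-- In `M_k`, let `q ∈ (0,1]` satisfy `⌈kq⌉ = 2` and let `P1'` be the
preference of `d1` ranking `x¹ P ∅` with all other contracts unacceptable. Then `P1'`
is an obvious manipulation of `φ^q` at the true preference `P1`: it is a manipulation,
and both `W_{d1}(P1, O^{φ^q}(P1')) P1 W_{d1}(P1, O^{φ^q}(P1))` and
`C_{d1}(P1, O^{φ^q}(P1')) P1 C_{d1}(P1, O^{φ^q}(P1))` hold. -/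
theorem truncation_is_obvious_manipulation (k : ℕ) (hk : 2 ≤ k)
    (q : ℝ) (hq0 : 0 < q) (hq1 : q ≤ 1) (hceil : ⌈(k : ℝ) * q⌉ = 2)
    (Q1 : (Mk k).DocPref false) (hQ1 : IsTruncation k (by omega) Q1) :
    (Mk k).IsManipulation ((Mk k).quantileMech q) false (P1 k) Q1 ∧
    (∃ a b, (Mk k).IsWorst false (P1 k) ((Mk k).optionSet ((Mk k).quantileMech q) false Q1) a ∧
      (Mk k).IsWorst false (P1 k) ((Mk k).optionSet ((Mk k).quantileMech q) false (P1 k)) b ∧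
      (P1 k).lt b a) ∧
    (∃ a b, (Mk k).IsBest false (P1 k) ((Mk k).optionSet ((Mk k).quantileMech q) false Q1) a ∧
      (Mk k).IsBest false (P1 k) ((Mk k).optionSet ((Mk k).quantileMech q) false (P1 k)) b ∧
      (P1 k).lt b a) := by
  have hT : ∀ P : (Mk k).Prof, P false = Q1 → _ := fun _ hP =>
    assign_of_truncation (by omega) hq0 hq1 hQ1 hP
  have hO : ∀ P : (Mk k).Prof, P false = P1 k → _ := fun _ hP => assign_of_P1 hk hceil hP
  have hlt : (P1 k).lt (some (xC k ⟨1, hk⟩)) (some (xC k ⟨0, by omega⟩)) :=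
    P1_lt_iff.2 (Nat.zero_lt_one)
  rw [Market.optionSet_eq_singleton hT, Market.optionSet_eq_singleton hO]
  exact ⟨Market.isManipulation_of_lt hT hO hlt,
    ⟨_, _, Market.isWorst_singleton _ _, Market.isWorst_singleton _ _, hlt⟩,
    ⟨_, _, Market.isBest_singleton _ _, Market.isBest_singleton _ _, hlt⟩⟩
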